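/- For L > 1/2 and K > 0, the jointly optimal peak AoI A_p* = [L(√(1+4/L)+1)+2]/(2e^{-2/(√(1+4/L)+1)-K}) grows at most linearly in L: there exist constants a, b > 0 (depending only on K) with A_p* ≤ aL + b for all L > 1/2. Specifically, since 2/(√(1+4/L)+1) ≤ 1 and √(1+4/L)+1 ≤ 2 + 2/L for L ≥ 1, one has A_p* ≤ (2L + 4)·e^{1+K} for L ≥ 1. -/

import Mathlib

open Real Set

theorem stmt17 (K : ℝ) (hK : 0 < K) :
    let A := fun L : ℝ => (L * (Real.sqrt (1 + 4 / L) + 1) + 2) /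
      (2 * Real.exp (-2 / (Real.sqrt (1 + 4 / L) + 1) - K));
    (∃ a b : ℝ, 0 < a ∧ 0 < b ∧ ∀ L : ℝ, 1 / 2 < L → A L ≤ a * L + b) ∧
    ∀ L : ℝ, 1 ≤ L → A L ≤ (2 * L + 4) * Real.exp (1 + K) := by
  intro A
  have key : ∀ L : ℝ, 0 < L → A L ≤ (2 * L + 4) * Real.exp (1 + K) := by
    intro L hL
    have hd : 0 < 4 / L := by positivity
    have h1 : 1 ≤ Real.sqrt (1 + 4 / L) := Real.one_le_sqrt.mpr (by linarith)
    have h2 : Real.sqrt (1 + 4 / L) ≤ 1 + 2 / L := by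
      apply Real.sqrt_le_iff.mpr
      refine ⟨by positivity, ?_⟩
      have e : (1 + 2 / L) ^ 2 = 1 + 4 / L + (2 / L) ^ 2 := by ring
      rw [e]
      linarith [sq_nonneg (2 / L)]
    change (L * (Real.sqrt (1 + 4 / L) + 1) + 2) /
      (2 * Real.exp (-2 / (Real.sqrt (1 + 4 / L) + 1) - K)) ≤ _
    generalize Real.sqrt (1 + 4 / L) = s at h1 h2
    have h3 : L * s ≤ L + 2 := by
      have h4 := mul_le_mul_of_nonneg_left h2 hL.le
      have h5 : L * (1 + 2 / L) = L + 2 := by field_simp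
      linarith
    have h6 : -1 ≤ -2 / (s + 1) := by
      rw [le_div_iff₀ (by linarith)]
      linarith
    have h7 : 1 ≤ Real.exp (1 + K) * Real.exp (-2 / (s + 1) - K) := by
      rw [← Real.exp_add]
      exact Real.one_le_exp (by linarith)
    rw [div_le_iff₀ (by positivity)]
    have h8 := mul_le_mul_of_nonneg_left h7 (show 0 ≤ 2 * (2 * L + 4) by positivity)
    nlinarith
  refine ⟨⟨2 * Real.exp (1 + K), 4 * Real.exp (1 + K), by positivity, by positivity, ?_⟩, ?_⟩
  · intro L hL
    have := key L (by linarith)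
    linarith
  · intro L hL
    exact key L (by linarith)
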